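/- Let (k_i)_{i≥1} be a sequence of positive integers satisfying condition (★) with liminf_{i→∞} k_i < ∞. Then the subshift (X,σ) is uniquely ergodic: there is exactly one σ-invariant Borel probability measure on X. -/

import Mathlib

open Filter Topology MeasureTheory

/-- The substitution `χ_k` on the alphabet `{1,2,3}`, coded as `Fin 3 = {0,1,2}`
(letter 1 ↦ 0, letter 2 ↦ 1, letter 3 ↦ 2):
`χ_k(1) = 2`, `χ_k(2) = 3 1^k`, `χ_k(3) = 3 1^(k-1)`. -/
def chiSub (k : ℕ) : Fin 3 → List (Fin 3) :=
  ![[1], 2 :: List.replicate k 0, 2 :: List.replicate (k - 1) 0]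

/-- Extension of `χ_k` to finite words by concatenation. -/
def applyChi (k : ℕ) (w : List (Fin 3)) : List (Fin 3) := w.flatMap (chiSub k)

/-- `compApply k n w = χ_{k 1} ∘ χ_{k 2} ∘ ⋯ ∘ χ_{k n} (w)`. -/
def compApply (k : ℕ → ℕ) : ℕ → List (Fin 3) → List (Fin 3)
  | 0, w => w
  | n + 1, w => compApply k n (applyChi (k (n + 1)) w)

/-- Condition (★): k_{2i} > 1` for infinitely many `i` and `k_{2i-1} > 1`
for infinitely many `i`. -/
def StarCond (k : ℕ → ℕ) : Prop :=
  (∀ N, ∃ i ≥ N, 1 < k (2 * i)) ∧ (∀ N, ∃ i ≥ N, 1 < k (2 * i - 1))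

/-- `w` is a prefix of the infinite sequence `x`. -/
def IsPrefixSeq (w : List (Fin 3)) (x : ℕ → Fin 3) : Prop :=
  w = List.ofFn fun i : Fin w.length => x i

/-- The left shift `σ`. -/
def shift (x : ℕ → Fin 3) : ℕ → Fin 3 := fun i => x (i + 1)

/-- The closure of the `σ`-orbit of `ρ`: the subshift `X`. -/
def orbitClosure (ρ : ℕ → Fin 3) : Set (ℕ → Fin 3) :=
  closure {y | ∃ n : ℕ, y = fun i => ρ (i + n)}

/-- A `σ`-invariant Borel probability measure on `X`, encoded as a measure on the full
product space giving `X` full mass. -/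
def IsInvProb (X : Set (ℕ → Fin 3)) (μ : Measure (ℕ → Fin 3)) : Prop :=
  IsProbabilityMeasure μ ∧ μ Xᶜ = 0 ∧ μ.map shift = μ

/-! ### Letter sums and the composed substitutions -/

theorem compApply_eq_flatMap (k : ℕ → ℕ) (n : ℕ) (w : List (Fin 3)) :
    compApply k n w = w.flatMap fun a => compApply k n [a] := by
  induction n generalizing w with
  | zero => simp [compApply]
  | succ n ih =>
    simp only [compApply]
    rw [ih, applyChi, List.flatMap_assoc]
    congr 1
    funext a
    rw [ih (applyChi _ _)]
    simp [applyChi]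

/-- The sum of a weight function over the letters of a word. -/
def letterSum (v : Fin 3 → ℝ) (w : List (Fin 3)) : ℝ := (w.map v).sum

/-- The weights on letters obtained by pulling a weight function back along `χ_{k 1}, …, χ_{k n}`. -/
def pullWeight (k : ℕ → ℕ) (v : Fin 3 → ℝ) : ℕ → Fin 3 → ℝ
  | 0 => v
  | n + 1 => fun a => letterSum (pullWeight k v n) (chiSub (k (n + 1)) a)

theorem letterSum_applyChi (v : Fin 3 → ℝ) (m : ℕ) (w : List (Fin 3)) :
    letterSum v (applyChi m w) = letterSum (fun a => letterSum v (chiSub m a)) w := by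
  induction w with
  | nil => simp [letterSum, applyChi]
  | cons a w ih =>
    simp only [letterSum, applyChi, List.flatMap_cons, List.map_append, List.sum_append,
      List.map_cons, List.sum_cons] at ih ⊢
    rw [ih]

/-- Weight functions evolving by the transposed incidence matrices of `χ_{k 1}, χ_{k 2}, …`. -/
structure IsChiCocycle (k : ℕ → ℕ) (v : ℕ → Fin 3 → ℝ) : Prop where
  zero : ∀ n, v (n + 1) 0 = v n 1
  one : ∀ n, v (n + 1) 1 = v (n + 1) 2 + v n 0
  two : ∀ n, v (n + 1) 2 = v n 2 + ((k (n + 1) : ℝ) - 1) * v n 0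

theorem isChiCocycle_of_letterSum {k : ℕ → ℕ} (hpos : ∀ i, 1 ≤ i → 1 ≤ k i) {v : ℕ → Fin 3 → ℝ}
    (hv : ∀ n a, v (n + 1) a = letterSum (v n) (chiSub (k (n + 1)) a)) : IsChiCocycle k v := by
  have h1 : ∀ n, ((k (n + 1) - 1 : ℕ) : ℝ) = (k (n + 1) : ℝ) - 1 := fun n => by
    rw [Nat.cast_sub (hpos _ (by omega))]; simp
  constructor
  · intro n; simp [hv, chiSub, letterSum]
  · intro n; simp [hv, chiSub, letterSum, h1]; ring
  · intro n; simp [hv, chiSub, letterSum, h1]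

theorem letterSum_length (k : ℕ → ℕ) (n : ℕ) (w : List (Fin 3)) :
    letterSum (fun a => ((compApply k n [a]).length : ℝ)) w = (compApply k n w).length := by
  rw [compApply_eq_flatMap k n w, List.length_flatMap]
  simp [letterSum, Function.comp_def]

theorem length_compApply_succ (k : ℕ → ℕ) (n : ℕ) (a : Fin 3) :
    ((compApply k (n + 1) [a]).length : ℝ) =
      letterSum (fun b => ((compApply k n [b]).length : ℝ)) (chiSub (k (n + 1)) a) := by
  rw [letterSum_length]
  simp [compApply, applyChi]

/-! ### Contraction of the ratios of two cocycles -/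

section Contraction

variable {k : ℕ → ℕ} {l v : ℕ → Fin 3 → ℝ}

theorem IsChiCocycle.nonneg_succ (hk : ∀ i, 1 ≤ i → 1 ≤ k i) (hv : IsChiCocycle k v) {n : ℕ}
    (h : ∀ a, 0 ≤ v n a) : ∀ a, 0 ≤ v (n + 1) a := by
  have h1 : (1 : ℝ) ≤ k (n + 1) := by exact_mod_cast hk _ (by omega)
  have h2 : 0 ≤ v (n + 1) 2 := by
    rw [hv.two]
    have := mul_nonneg (sub_nonneg.2 h1) (h 0)
    linarith [h 2]
  intro a
  fin_cases a
  · simpa [hv.zero] using h 1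
  · simpa [hv.one] using add_nonneg h2 (h 0)
  · simpa using h2

theorem IsChiCocycle.sub_mul (hv : IsChiCocycle k v) (hl : IsChiCocycle k l) (c : ℝ) :
    IsChiCocycle k fun n a => v n a - c * l n a := by
  constructor
  · intro n; simp only [hv.zero, hl.zero]
  · intro n; simp only [hv.one, hl.one]; ring
  · intro n; simp only [hv.two, hl.two]; ring

theorem IsChiCocycle.mul_sub (hv : IsChiCocycle k v) (hl : IsChiCocycle k l) (c : ℝ) :
    IsChiCocycle k fun n a => c * l n a - v n a := by
  constructor
  · intro n; simp only [hv.zero, hl.zero]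
  · intro n; simp only [hv.one, hl.one]; ring
  · intro n; simp only [hv.two, hl.two]; ring

theorem IsChiCocycle.nonneg_of_le (hk : ∀ i, 1 ≤ i → 1 ≤ k i) (hv : IsChiCocycle k v) {n : ℕ}
    (h : ∀ a, 0 ≤ v n a) {m : ℕ} (hnm : n ≤ m) : ∀ a, 0 ≤ v m a := by
  induction m, hnm using Nat.le_induction with
  | base => exact h
  | succ m _ ih => exact hv.nonneg_succ hk ih

/-- After a nontrivial step at `s` and a nontrivial step of the other parity later on, the weight of
the last letter dominates. -/
theorem IsChiCocycle.exists_dominated (hk : ∀ i, 1 ≤ i → 1 ≤ k i) (hl : IsChiCocycle k l)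
    (h0 : ∀ n a, 0 ≤ l n a) (s j : ℕ) (hs : 1 < k (s + 1)) (hj : 1 < k (s + 2 * j + 2)) :
    ∃ n ≥ s, l n 0 ≤ 2 * l n 2 ∧ l n 1 ≤ 2 * l n 2 := by
  have hex : ∃ j, 1 < k (s + 2 * j + 2) := ⟨j, hj⟩
  set J := Nat.find hex
  have hJ1 : 1 < k (s + 2 * J + 2) := Nat.find_spec hex
  have hmin : ∀ i < J, k (s + 2 * i + 2) = 1 := fun i hi => by
    have h1 := Nat.find_min hex hi
    have h2 := hk (s + 2 * i + 2) (by omega)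
    omega
  have key : ∀ i ≤ J, l (s + 2 * i + 1) 1 ≤ 2 * l (s + 2 * i + 1) 2 + l (s + 2 * i + 1) 0 := by
    intro i
    induction i with
    | zero =>
      intro _
      have hs' : (2 : ℝ) ≤ k (s + 1) := by exact_mod_cast hs
      have e1 := hl.one s
      have e2 := hl.two s
      have := h0 (s + 1) 0
      simp only [mul_zero, add_zero]
      nlinarith [h0 s 0, h0 s 2]
    | succ i ih =>
      intro hi
      have ih := ih (by omega)
      have ht := hmin i (by omega)
      rw [show s + 2 * (i + 1) + 1 = s + 2 * i + 1 + 1 + 1 by ring]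
      set n := s + 2 * i + 1
      have e1 := hl.one n
      have e2 := hl.two n
      have e3 := hl.zero n
      have e4 := hl.one (n + 1)
      have e5 := hl.two (n + 1)
      have e6 := hl.zero (n + 1)
      rw [show k (n + 1) = 1 from ht] at e2
      have hs' : (1 : ℝ) ≤ k (n + 1 + 1) := by exact_mod_cast hk _ (by omega)
      have := mul_nonneg (sub_nonneg.2 hs') (h0 (n + 1) 0)
      push_cast at e2
      linarith
  have hJ2 := key J le_rfl
  set n := s + 2 * J + 1
  refine ⟨n + 1, by omega, ?_⟩
  have e1 := hl.one n
  have e2 := hl.two n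
  have e3 := hl.zero n
  have hs' : (2 : ℝ) ≤ k (n + 1) := by exact_mod_cast hJ1
  have := h0 n 2
  have h3 := h0 n 0
  have : l n 0 ≤ ((k (n + 1) : ℝ) - 1) * l n 0 := by nlinarith
  constructor <;> linarith

/-- Domination of the last letter persists until a bounded step occurs. -/
theorem IsChiCocycle.exists_dominated_of_le (hk : ∀ i, 1 ≤ i → 1 ≤ k i) (hl : IsChiCocycle k l)
    (h0 : ∀ n a, 0 ≤ l n a) (hstar : ∀ N, ∃ s ≥ N, ∃ j, 1 < k (s + 1) ∧ 1 < k (s + 2 * j + 2))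
    {C : ℕ} (hC : ∀ N, ∃ i ≥ N, k i ≤ C) (hC1 : 1 ≤ C) (N : ℕ) :
    ∃ n ≥ N, k (n + 1) ≤ C ∧ l n 0 ≤ 2 * l n 2 ∧ l n 1 ≤ 2 * l n 2 := by
  by_contra! hcon
  obtain ⟨s, hsN, j, hs, hj⟩ := hstar N
  obtain ⟨n₀, hn₀, hd⟩ := hl.exists_dominated hk h0 s j hs hj
  have inv : ∀ n ≥ n₀, l n 0 ≤ 2 * l n 2 ∧ l n 1 ≤ 2 * l n 2 := by
    intro n hn
    induction n, hn using Nat.le_induction with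
    | base => exact hd
    | succ n hn ih =>
      have hbig : C < k (n + 1) := by
        by_contra! h
        exact absurd ih.2 (not_le.2 (hcon n (by omega) h ih.1))
      have hs' : (2 : ℝ) ≤ k (n + 1) := by exact_mod_cast (by omega : 2 ≤ k (n + 1))
      have e1 := hl.one n
      have e2 := hl.two n
      have e3 := hl.zero n
      have : l n 0 ≤ ((k (n + 1) : ℝ) - 1) * l n 0 := by nlinarith [h0 n 0]
      have := h0 n 2
      have := h0 n 0
      constructor <;> linarith
  obtain ⟨i, hi, hiC⟩ := hC (max n₀ N + 1)
  obtain ⟨n, rfl⟩ : ∃ n, i = n + 1 := ⟨i - 1, by omega⟩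
  have := inv n (by omega)
  exact absurd this.2 (not_le.2 (hcon n (by omega) hiC this.1))

/-- One bounded dominated step bounds a nonnegative cocycle below by its value at the last letter. -/
theorem IsChiCocycle.lower_bound (hk : ∀ i, 1 ≤ i → 1 ≤ k i) (hv : IsChiCocycle k v)
    (hl : IsChiCocycle k l) (h0 : ∀ n a, 0 ≤ l n a) {C : ℕ} {n : ℕ} (hC : k (n + 1 + 1) ≤ C)
    (hd0 : l (n + 1) 0 ≤ 2 * l (n + 1) 2) (hd1 : l (n + 1) 1 ≤ 2 * l (n + 1) 2)
    (hvn : ∀ a, 0 ≤ v n a) {δ : ℝ} (hδ : 0 ≤ δ) (hγ : (2 * C + 2) * δ * l (n + 1) 2 ≤ v (n + 1) 2) :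
    ∀ a, δ * l (n + 2) a ≤ v (n + 2) a := by
  have hvn1 := hv.nonneg_succ hk hvn
  have hk1 : (1 : ℝ) ≤ k (n + 1 + 1) := by exact_mod_cast hk _ (by omega)
  have hkC : (k (n + 1 + 1) : ℝ) ≤ C := by exact_mod_cast hC
  have e1 := hl.one (n + 1)
  have e2 := hl.two (n + 1)
  have e3 := hl.zero (n + 1)
  have f1 := hv.one (n + 1)
  have f2 := hv.two (n + 1)
  have f3 := hv.zero (n + 1)
  have f4 := hv.one n
  have hc := h0 (n + 1) 2
  have ha := h0 (n + 1) 0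
  have g1 : (k (n + 1 + 1) : ℝ) * l (n + 1) 0 ≤ C * (2 * l (n + 1) 2) := by gcongr
  have g2 := mul_nonneg (sub_nonneg.2 hk1) (hvn1 0)
  have g3 : l (n + 2) 1 ≤ (2 * C + 2) * l (n + 1) 2 := by
    rw [e1, e2]; linarith
  have g4 : l (n + 2) 2 ≤ (2 * C + 2) * l (n + 1) 2 := by
    rw [e2]; linarith
  have g5 : l (n + 2) 0 ≤ (2 * C + 2) * l (n + 1) 2 := by
    rw [e3]
    have : (0 : ℝ) ≤ C * l (n + 1) 2 := by positivity
    linarith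
  have hle : ∀ a, l (n + 2) a ≤ (2 * C + 2) * l (n + 1) 2 := by
    intro a
    fin_cases a
    · exact g5
    · exact g3
    · exact g4
  have hve : ∀ a, v (n + 1) 2 ≤ v (n + 2) a := by
    intro a
    fin_cases a
    · change _ ≤ v (n + 2) 0
      rw [f3, f4]
      linarith [hvn 0]
    · change _ ≤ v (n + 2) 1
      rw [f1, f2]
      linarith [hvn1 0]
    · change _ ≤ v (n + 2) 2
      rw [f2]
      linarith
  intro a
  have := mul_le_mul_of_nonneg_left (hle a) hδ
  linarith [hve a]

theorem IsChiCocycle.exists_ratio_contraction (hk : ∀ i, 1 ≤ i → 1 ≤ k i) (hv : IsChiCocycle k v)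
    (hl : IsChiCocycle k l) (h0 : ∀ n a, 0 ≤ l n a)
    (hstar : ∀ N, ∃ s ≥ N, ∃ j, 1 < k (s + 1) ∧ 1 < k (s + 2 * j + 2))
    {C : ℕ} (hC : ∀ N, ∃ i ≥ N, k i ≤ C) (hC1 : 1 ≤ C) {N : ℕ} {lo w : ℝ} (hw : 0 ≤ w)
    (hlo : ∀ a, lo * l N a ≤ v N a) (hhi : ∀ a, v N a ≤ (lo + w) * l N a) :
    ∃ n ≥ N, ∃ lo', (∀ a, lo' * l n a ≤ v n a) ∧
      ∀ a, v n a ≤ (lo' + (1 - 1 / (4 * C + 4)) * w) * l n a := by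
  obtain ⟨n', hn', hkC, hd0, hd1⟩ := hl.exists_dominated_of_le hk h0 hstar hC hC1 (N + 1)
  obtain ⟨n, rfl⟩ : ∃ n, n' = n + 1 := ⟨n' - 1, by omega⟩
  have hA := hv.sub_mul hl lo
  have hB := hv.mul_sub hl (lo + w)
  have hA0 := hA.nonneg_of_le hk (n := N) (m := n) (fun a => by linarith [hlo a]) (by omega)
  have hB0 := hB.nonneg_of_le hk (n := N) (m := n) (fun a => by linarith [hhi a]) (by omega)
  have hA2 := hA.nonneg_of_le hk hA0 (m := n + 2) (by omega)
  have hB2 := hB.nonneg_of_le hk hB0 (m := n + 2) (by omega)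
  set δ : ℝ := 1 / (4 * C + 4) * w with hδdef
  have hδ : 0 ≤ δ := by positivity
  have hδ2 : (2 * C + 2) * δ = w / 2 := by rw [hδdef]; field_simp; ring
  refine ⟨n + 2, by omega, ?_⟩
  rcases le_total ((lo + w / 2) * l (n + 1) 2) (v (n + 1) 2) with h | h
  · have := hA.lower_bound hk hl h0 hkC hd0 hd1 hA0 hδ (by rw [hδ2]; linarith)
    refine ⟨lo + δ, fun a => by linarith [this a], fun a => ?_⟩
    have h2 := hB2 a
    calc v (n + 2) a ≤ (lo + w) * l (n + 2) a := by linarith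
      _ = _ := by rw [hδdef]; ring
  · have := hB.lower_bound hk hl h0 hkC hd0 hd1 hB0 hδ (by rw [hδ2]; linarith)
    refine ⟨lo, fun a => by linarith [hA2 a], fun a => ?_⟩
    calc v (n + 2) a ≤ (lo + w - δ) * l (n + 2) a := by linarith [this a]
      _ = _ := by rw [hδdef]; ring

theorem IsChiCocycle.exists_ratio_close (hk : ∀ i, 1 ≤ i → 1 ≤ k i) (hv : IsChiCocycle k v)
    (hl : IsChiCocycle k l) (h0 : ∀ n a, 0 ≤ l n a)
    (hstar : ∀ N, ∃ s ≥ N, ∃ j, 1 < k (s + 1) ∧ 1 < k (s + 2 * j + 2))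
    {C : ℕ} (hC : ∀ N, ∃ i ≥ N, k i ≤ C) (hvl : ∀ a, |v 0 a| ≤ l 0 a) {ε : ℝ} (hε : 0 < ε) :
    ∃ n L, ∀ a, |v n a - L * l n a| ≤ ε * l n a := by
  have hC' : ∀ N, ∃ i ≥ N, k i ≤ C + 1 := fun N => by
    obtain ⟨i, hi, h⟩ := hC N
    exact ⟨i, hi, by omega⟩
  set q : ℝ := 1 - 1 / (4 * ((C + 1 : ℕ) : ℝ) + 4) with hq
  have hq1 : q < 1 := by
    rw [hq]
    have : (0 : ℝ) < 1 / (4 * ((C + 1 : ℕ) : ℝ) + 4) := by positivity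
    linarith
  have hq0 : 0 ≤ q := by
    rw [hq, sub_nonneg, div_le_one (by positivity)]
    have : (0 : ℝ) ≤ ((C + 1 : ℕ) : ℝ) := by positivity
    linarith
  have key : ∀ j : ℕ, ∃ n lo, (∀ a, lo * l n a ≤ v n a) ∧ ∀ a, v n a ≤ (lo + q ^ j * 2) * l n a := by
    intro j
    induction j with
    | zero =>
      refine ⟨0, -1, fun a => ?_, fun a => ?_⟩
      · linarith [(abs_le.1 (hvl a)).1]
      · linarith [(abs_le.1 (hvl a)).2]
    | succ j ih =>
      obtain ⟨n, lo, h1, h2⟩ := ih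
      obtain ⟨m, -, lo', h3, h4⟩ := hv.exists_ratio_contraction hk hl h0 hstar hC' (by omega)
        (by positivity) h1 h2
      exact ⟨m, lo', h3, fun a => (h4 a).trans_eq (by rw [← hq]; ring)⟩
  obtain ⟨j, hj⟩ := exists_pow_lt_of_lt_one (half_pos hε) hq1
  obtain ⟨n, lo, h1, h2⟩ := key j
  refine ⟨n, lo, fun a => ?_⟩
  rw [abs_of_nonneg (by linarith [h1 a])]
  have := mul_le_mul_of_nonneg_right (show q ^ j * 2 ≤ ε by linarith) (h0 n a)
  linarith [h2 a]

end Contraction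

/-! ### Lengths of the composed words -/

theorem isChiCocycle_length {k : ℕ → ℕ} (hpos : ∀ i, 1 ≤ i → 1 ≤ k i) :
    IsChiCocycle k fun n a => ((compApply k n [a]).length : ℝ) :=
  isChiCocycle_of_letterSum hpos (length_compApply_succ k)

theorem IsChiCocycle.comp_add {k : ℕ → ℕ} {v : ℕ → Fin 3 → ℝ} (hv : IsChiCocycle k v) (p : ℕ) :
    IsChiCocycle (fun i => k (p + i)) fun n => v (p + n) :=
  ⟨fun n => hv.zero (p + n), fun n => hv.one (p + n), fun n => hv.two (p + n)⟩

theorem IsChiCocycle.one_le {k : ℕ → ℕ} (hk : ∀ i, 1 ≤ i → 1 ≤ k i) {l : ℕ → Fin 3 → ℝ}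
    (hl : IsChiCocycle k l) (h1 : ∀ a, 1 ≤ l 0 a) (n : ℕ) : ∀ a, 1 ≤ l n a := by
  induction n with
  | zero => exact h1
  | succ n ih =>
    have hk1 : (1 : ℝ) ≤ k (n + 1) := by exact_mod_cast hk _ (by omega)
    have h2 : 1 ≤ l (n + 1) 2 := by
      rw [hl.two]
      have := mul_nonneg (sub_nonneg.2 hk1) (zero_le_one.trans (ih 0))
      linarith [ih 2]
    intro a
    fin_cases a
    · simpa [hl.zero] using ih 1
    · have := hl.one n
      have := ih 0
      change 1 ≤ l (n + 1) 1
      linarith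
    · exact h2

theorem IsChiCocycle.exists_forall_ge_le {k : ℕ → ℕ} (hk : ∀ i, 1 ≤ i → 1 ≤ k i) {l : ℕ → Fin 3 → ℝ}
    (hl : IsChiCocycle k l) (h1 : ∀ a, 1 ≤ l 0 a) (hinf : ∀ N, ∃ s ≥ N, 1 < k (s + 1)) (B : ℕ) :
    ∃ n, ∀ m ≥ n, ∀ a, (B : ℝ) ≤ l m a := by
  have hone := hl.one_le hk h1
  have hstep : ∀ n, l n 2 ≤ l (n + 1) 2 := fun n => by
    have hk1 : (1 : ℝ) ≤ k (n + 1) := by exact_mod_cast hk _ (by omega)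
    have := mul_nonneg (sub_nonneg.2 hk1) (zero_le_one.trans (hone n 0))
    linarith [hl.two n]
  have hmono : Monotone fun n => l n 2 := monotone_nat_of_le_succ hstep
  have key : ∃ n, (B : ℝ) ≤ l n 2 := by
    induction B with
    | zero => exact ⟨0, by simpa using zero_le_one.trans (h1 2)⟩
    | succ B ih =>
      obtain ⟨n, hn⟩ := ih
      obtain ⟨s, hs, hks⟩ := hinf n
      refine ⟨s + 1, ?_⟩
      have hk2 : (2 : ℝ) ≤ k (s + 1) := by exact_mod_cast hks
      have h3 : l n 2 ≤ l s 2 := hmono hs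
      have h4 := hone s 0
      have h5 := hl.two s
      push_cast
      nlinarith
  obtain ⟨n, hn⟩ := key
  have h2 : ∀ m ≥ n, (B : ℝ) ≤ l m 2 := fun m hm => hn.trans (hmono hm)
  have h3 : ∀ m ≥ n + 1, (B : ℝ) ≤ l m 1 := fun m hm => by
    obtain ⟨j, rfl⟩ : ∃ j, m = j + 1 := ⟨m - 1, by omega⟩
    rw [hl.one]
    linarith [h2 (j + 1) (by omega), hone j 0]
  refine ⟨n + 2, fun m hm a => ?_⟩
  obtain ⟨j, rfl⟩ : ∃ j, m = j + 1 := ⟨m - 1, by omega⟩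
  fin_cases a
  · simpa [hl.zero] using h3 j (by omega)
  · exact h3 _ (by omega)
  · exact h2 _ (by omega)

/-! ### Cutting factors into blocks -/

theorem prefix_flatMap_decomp {α β : Type*} {f : α → List β} {R : ℕ} (hR : ∀ a, (f a).length ≤ R)
    (y : List α) {w : List β} (hw : w <+: y.flatMap f) :
    ∃ (z : List α) (t : List β), w = z.flatMap f ++ t ∧ t.length ≤ R := by
  induction y generalizing w with
  | nil =>
    rw [List.flatMap_nil, List.prefix_nil] at hw
    exact ⟨[], [], by simp [hw], by simp⟩
  | cons a y ih =>
    obtain ⟨r, hr⟩ := hw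
    rw [List.flatMap_cons, List.append_eq_append_iff] at hr
    rcases hr with ⟨s, hs, -⟩ | ⟨t, rfl, ht⟩
    · exact ⟨[], w, by simp, (List.IsPrefix.length_le ⟨s, hs.symm⟩).trans (hR a)⟩
    · obtain ⟨z, t', rfl, ht'⟩ := ih ⟨r, ht.symm⟩
      exact ⟨a :: z, t', by simp, ht'⟩

theorem infix_flatMap_decomp {α β : Type*} {f : α → List β} {R : ℕ} (hR : ∀ a, (f a).length ≤ R)
    (y : List α) {w : List β} (hw : w <:+: y.flatMap f) :
    ∃ (s : List β) (z : List α) (t : List β), w = s ++ (z.flatMap f ++ t) ∧ s.length ≤ R ∧ t.length ≤ R := by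
  induction y with
  | nil =>
    rw [List.flatMap_nil, List.infix_nil] at hw
    exact ⟨[], [], [], by simp [hw], by simp, by simp⟩
  | cons a y ih =>
    rw [List.flatMap_cons, List.infix_append_iff] at hw
    rcases hw with hw | hw | ⟨s, t, rfl, hs, ht⟩
    · exact ⟨w, [], [], by simp, hw.length_le.trans (hR a), by simp⟩
    · exact ih hw
    · obtain ⟨z, t', rfl, ht'⟩ := prefix_flatMap_decomp hR y ht
      exact ⟨s, z, t', by simp, hs.length_le.trans (hR a), ht'⟩

/-! ### Uniform frequencies -/

theorem abs_sub_letterSum_le {β : Type*} {T : List β → ℝ} {K : ℝ} (hT0 : T [] = 0)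
    (hT : ∀ u v, |T (u ++ v) - T u - T v| ≤ K) (f : Fin 3 → List β) (y : List (Fin 3)) :
    |T (y.flatMap f) - letterSum (fun a => T (f a)) y| ≤ K * y.length := by
  induction y with
  | nil => simp [hT0, letterSum]
  | cons a y ih =>
    simp only [List.flatMap_cons, letterSum, List.map_cons, List.sum_cons, List.length_cons] at ih ⊢
    have h1 := abs_le.1 (hT (f a) (y.flatMap f))
    have h2 := abs_le.1 ih
    push_cast
    rw [abs_le]
    constructor <;> linarith [h1.1, h1.2, h2.1, h2.2]

theorem letterSum_le_letterSum {u v : Fin 3 → ℝ} (h : ∀ a, u a ≤ v a) (w : List (Fin 3)) :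
    letterSum u w ≤ letterSum v w :=
  List.sum_le_sum fun a _ => h a

theorem letterSum_mul (c : ℝ) (v : Fin 3 → ℝ) (w : List (Fin 3)) :
    letterSum (fun a => c * v a) w = c * letterSum v w := by
  induction w with
  | nil => simp [letterSum]
  | cons a w ih =>
    simp only [letterSum, List.map_cons, List.sum_cons] at ih ⊢
    rw [ih]; ring

theorem abs_letterSum_sub_le {u l : Fin 3 → ℝ} {L ε : ℝ} (h : ∀ a, |u a - L * l a| ≤ ε * l a)
    (w : List (Fin 3)) : |letterSum u w - L * letterSum l w| ≤ ε * letterSum l w := by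
  induction w with
  | nil => simp [letterSum]
  | cons a w ih =>
    simp only [letterSum, List.map_cons, List.sum_cons] at ih ⊢
    have h1 := abs_le.1 (h a)
    have h2 := abs_le.1 ih
    rw [abs_le]
    constructor <;> linarith [h1.1, h1.2, h2.1, h2.2]

theorem abs_sub_pullWeight_le {k : ℕ → ℕ} {T : List (Fin 3) → ℝ} {p : ℕ} {δ : ℝ}
    (h : ∀ y, |T (compApply k p y) - letterSum (fun a => T (compApply k p [a])) y| ≤
      δ * (compApply k p y).length) (n : ℕ) (y : List (Fin 3)) :
    |T (compApply k (p + n) y) -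
      letterSum (pullWeight (fun i => k (p + i)) (fun a => T (compApply k p [a])) n) y| ≤
      δ * (compApply k (p + n) y).length := by
  induction n generalizing y with
  | zero => exact h y
  | succ n ih =>
    have := ih (applyChi (k (p + (n + 1))) y)
    rw [letterSum_applyChi] at this
    exact this

/-- A bounded almost additive function on words has uniform averages along the factors of the words
`compApply k n y`. -/
theorem exists_uniform_average {k : ℕ → ℕ} (hpos : ∀ i, 1 ≤ i → 1 ≤ k i)
    (hstar : ∀ N, ∃ s ≥ N, ∃ j, 1 < k (s + 1) ∧ 1 < k (s + 2 * j + 2))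
    {C : ℕ} (hC : ∀ N, ∃ i ≥ N, k i ≤ C) {T : List (Fin 3) → ℝ} {K : ℝ}
    (hT : ∀ u v, |T (u ++ v) - T u - T v| ≤ K) (hTl : ∀ u, |T u| ≤ u.length)
    {ε : ℝ} (hε : 0 < ε) :
    ∃ n L N, ∀ y w, w <:+: compApply k n y → N ≤ w.length →
      |T w - L * w.length| ≤ ε * w.length := by
  have hT0 : T [] = 0 := by simpa using hTl []
  set l : ℕ → Fin 3 → ℝ := fun n a => ((compApply k n [a]).length : ℝ) with hldef
  have hl : IsChiCocycle k l := isChiCocycle_length hpos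
  obtain ⟨P, hP⟩ := exists_nat_gt (K / (ε / 4))
  obtain ⟨p, hp⟩ := hl.exists_forall_ge_le hpos (fun a => by simp [hldef, compApply])
    (fun N => by obtain ⟨s, hs, j, h, -⟩ := hstar N; exact ⟨s, hs, h⟩) P
  have hKP : K ≤ ε / 4 * P := by
    rw [div_lt_iff₀ (by positivity)] at hP
    linarith
  have hbase : ∀ y, |T (compApply k p y) - letterSum (fun a => T (compApply k p [a])) y| ≤
      ε / 4 * (compApply k p y).length := by
    intro y
    have h1 := abs_sub_letterSum_le hT0 hT (fun a => compApply k p [a]) y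
    rw [← compApply_eq_flatMap] at h1
    refine h1.trans ?_
    rw [← letterSum_length, ← letterSum_mul]
    have h2 : letterSum (fun _ => K) y ≤ letterSum (fun a => ε / 4 * l p a) y :=
      letterSum_le_letterSum (fun a => hKP.trans (by gcongr; exact hp p le_rfl a)) y
    have h3 : letterSum (fun _ => K) y = K * y.length := by simp [letterSum, mul_comm]
    rwa [h3] at h2
  set k' : ℕ → ℕ := fun i => k (p + i) with hk'
  have hv : IsChiCocycle k' (pullWeight k' fun a => T (compApply k p [a])) :=
    isChiCocycle_of_letterSum (fun i hi => hpos _ (by omega)) fun n a => rfl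
  obtain ⟨n, L, hL⟩ := hv.exists_ratio_close (fun i hi => hpos _ (by omega)) (hl.comp_add p)
    (fun n a => by simp [hldef])
    (fun N => by
      obtain ⟨s, hs, j, h1, h2⟩ := hstar (p + N)
      obtain ⟨t, rfl⟩ : ∃ t, s = p + t := ⟨s - p, by omega⟩
      exact ⟨t, by omega, j, h1, by simpa only [hk', ← add_assoc] using h2⟩)
    (C := C)
    (fun N => by
      obtain ⟨s, hs, h⟩ := hC (p + N)
      obtain ⟨t, rfl⟩ : ∃ t, s = p + t := ⟨s - p, by omega⟩
      exact ⟨t, by omega, h⟩)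
    (fun a => hTl _) (ε := ε / 4) (by positivity)
  have hblock : ∀ y, |T (compApply k (p + n) y) - L * (compApply k (p + n) y).length| ≤
      ε / 2 * (compApply k (p + n) y).length := by
    intro y
    have h1 := abs_le.1 (abs_sub_pullWeight_le hbase n y)
    have h2 := abs_le.1 (abs_letterSum_sub_le hL y)
    rw [hldef, letterSum_length] at h2
    rw [abs_le]
    constructor <;> linarith [h1.1, h1.2, h2.1, h2.2]
  set R : ℕ := ∑ a, (compApply k (p + n) [a]).length with hR
  have hRa : ∀ a, (compApply k (p + n) [a]).length ≤ R := fun a =>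
    Finset.single_le_sum (f := fun a => (compApply k (p + n) [a]).length)
      (fun _ _ => Nat.zero_le _) (Finset.mem_univ a)
  obtain ⟨N, hN⟩ := exists_nat_gt ((2 * R + 2 * K + 2 * R * |L|) / (ε / 2))
  refine ⟨p + n, L, N, fun y w hw hNw => ?_⟩
  rw [compApply_eq_flatMap] at hw
  obtain ⟨s, z, t, rfl, hs, ht⟩ := infix_flatMap_decomp hRa y hw
  rw [← compApply_eq_flatMap] at hNw ⊢
  set u := compApply k (p + n) z with hu
  have h1 := abs_le.1 (hT s (u ++ t))
  have h2 := abs_le.1 (hT u t)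
  have h3 := abs_le.1 (hTl s)
  have h4 := abs_le.1 (hTl t)
  have h5 := abs_le.1 (hblock z)
  rw [← hu] at h5
  have hs' : (s.length : ℝ) ≤ R := by exact_mod_cast hs
  have ht' : (t.length : ℝ) ≤ R := by exact_mod_cast ht
  have h6 : |L * (s.length + t.length)| ≤ 2 * R * |L| := by
    rw [abs_mul, abs_of_nonneg (by positivity : (0 : ℝ) ≤ s.length + t.length)]
    nlinarith [abs_nonneg L]
  have h6 := abs_le.1 h6
  have h7 : ((N : ℝ)) ≤ (s ++ (u ++ t)).length := by exact_mod_cast hNw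
  rw [div_lt_iff₀ (by positivity)] at hN
  have h8 := mul_le_mul_of_nonneg_left h7 (by positivity : 0 ≤ ε / 2)
  simp only [List.length_append, Nat.cast_add] at h8 ⊢
  have h9 : 0 ≤ ε * s.length := by positivity
  have h10 : 0 ≤ ε * t.length := by positivity
  rw [abs_le]
  constructor <;> linarith [h1.1, h1.2, h2.1, h2.2, h3.1, h3.2, h4.1, h4.2, h5.1, h5.2, h6.1, h6.2]

/-! ### Birkhoff sums of functions of finitely many coordinates -/

/-- The Birkhoff sum of `g` over the first `n` shifts of `x`. -/
def birkhoff (g : (ℕ → Fin 3) → ℝ) (n : ℕ) (x : ℕ → Fin 3) : ℝ :=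
  ∑ j ∈ Finset.range n, g fun i => x (i + j)

/-- The function `g` depends only on the first `m` coordinates. -/
def DependsOnFirst (m : ℕ) (g : (ℕ → Fin 3) → ℝ) : Prop :=
  ∀ x y, (∀ i < m, x i = y i) → g x = g y

section Birkhoff

variable {m : ℕ} {g : (ℕ → Fin 3) → ℝ}

theorem DependsOnFirst.abs_birkhoff_sub_le (hg : DependsOnFirst m g) (hg1 : ∀ x, |g x| ≤ 1) {n : ℕ}
    {x y : ℕ → Fin 3} (hxy : ∀ i < n, x i = y i) : |birkhoff g n x - birkhoff g n y| ≤ 2 * m := by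
  rw [birkhoff, birkhoff, ← Finset.sum_sub_distrib]
  calc |∑ j ∈ Finset.range n, ((g fun i => x (i + j)) - g fun i => y (i + j))|
      ≤ ∑ j ∈ Finset.range n, |(g fun i => x (i + j)) - g fun i => y (i + j)| :=
        Finset.abs_sum_le_sum_abs _ _
    _ ≤ ∑ j ∈ Finset.range n, if n < j + m then (2 : ℝ) else 0 := by
        refine Finset.sum_le_sum fun j _ => ?_
        split_ifs with h
        · have h1 := abs_le.1 (hg1 fun i => x (i + j))
          have h2 := abs_le.1 (hg1 fun i => y (i + j))
          rw [abs_le]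
          constructor <;> linarith [h1.1, h1.2, h2.1, h2.2]
        · rw [hg _ _ fun i hi => hxy (i + j) (by omega), sub_self, abs_zero]
    _ = 2 * ((Finset.range n).filter fun j => n < j + m).card := by
        rw [← Finset.sum_filter, Finset.sum_const, nsmul_eq_mul, mul_comm]
    _ ≤ 2 * m := by
        gcongr
        calc ((Finset.range n).filter fun j => n < j + m).card
            ≤ (Finset.Ico (n - m) n).card := Finset.card_le_card fun j hj => by
              simp only [Finset.mem_filter, Finset.mem_range, Finset.mem_Ico] at hj ⊢
              omega
          _ ≤ m := by rw [Nat.card_Ico]; omega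

theorem abs_birkhoff_le (hg1 : ∀ x, |g x| ≤ 1) (n : ℕ) (x : ℕ → Fin 3) :
    |birkhoff g n x| ≤ n := by
  refine (Finset.abs_sum_le_sum_abs _ _).trans ?_
  refine (Finset.sum_le_sum fun j _ => hg1 _).trans ?_
  simp

/-- The Birkhoff sum of `g` along a finite word, padded by a constant letter. -/
def wordSum (g : (ℕ → Fin 3) → ℝ) (w : List (Fin 3)) : ℝ :=
  birkhoff g w.length fun i => w.getD i 0

theorem birkhoff_add (a b : ℕ) (x : ℕ → Fin 3) :
    birkhoff g (a + b) x = birkhoff g a x + birkhoff g b fun i => x (i + a) := by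
  simp only [birkhoff, Finset.sum_range_add]
  congr 1
  refine Finset.sum_congr rfl fun j _ => ?_
  congr 1
  funext i
  congr 1
  omega

theorem DependsOnFirst.abs_wordSum_append_le (hg : DependsOnFirst m g) (hg1 : ∀ x, |g x| ≤ 1)
    (u v : List (Fin 3)) : |wordSum g (u ++ v) - wordSum g u - wordSum g v| ≤ 2 * m := by
  have h : wordSum g (u ++ v) - wordSum g v = birkhoff g u.length fun i => (u ++ v).getD i 0 := by
    rw [wordSum, List.length_append, birkhoff_add, wordSum]
    have : (fun i => (u ++ v).getD (i + u.length) 0) = fun i => v.getD i 0 := by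
      funext i
      rw [List.getD_append_right _ _ _ _ (by omega)]
      simp
    rw [this]
    ring
  rw [sub_right_comm, h]
  exact hg.abs_birkhoff_sub_le hg1 fun i hi => List.getD_append _ _ _ _ hi

theorem isOpen_agree (x : ℕ → Fin 3) (M : ℕ) : IsOpen {y : ℕ → Fin 3 | ∀ i < M, y i = x i} := by
  have : {y : ℕ → Fin 3 | ∀ i < M, y i = x i} = (Set.Iio M).pi fun i => {x i} := by
    ext y; simp [Set.mem_pi]
  rw [this]
  exact isOpen_set_pi (Set.finite_Iio M) fun i _ => isOpen_discrete _

/-- Uniform Birkhoff averages on an orbit closure all of whose factors are controlled. -/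
theorem DependsOnFirst.exists_birkhoff_close (hg : DependsOnFirst m g) (hg1 : ∀ x, |g x| ≤ 1)
    {ρ : ℕ → Fin 3} {ε L : ℝ} (hε : 0 < ε) {N : ℕ}
    (h : ∀ i n, N ≤ n → |wordSum g (List.ofFn fun j : Fin n => ρ (j + i)) - L * n| ≤ ε / 2 * n) :
    ∃ n : ℕ, 0 < n ∧ ∀ x ∈ orbitClosure ρ, |birkhoff g n x - L * n| ≤ ε * n := by
  obtain ⟨M, hM⟩ := exists_nat_gt (2 * m / (ε / 2))
  set n := max (max M N) 1 with hn
  refine ⟨n, by omega, fun x hx => ?_⟩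
  obtain ⟨y, hy, i, rfl⟩ := mem_closure_iff.1 hx _ (isOpen_agree x (n + m)) (fun _ _ => rfl)
  have h1 : birkhoff g n x = birkhoff g n fun j => ρ (j + i) := by
    refine Finset.sum_congr rfl fun j hj => hg _ _ fun l hl => ?_
    rw [Finset.mem_range] at hj
    exact (hy (l + j) (by omega)).symm
  have h2 := h i n (by omega)
  have h3 : |wordSum g (List.ofFn fun j : Fin n => ρ (j + i)) - birkhoff g n fun j => ρ (j + i)| ≤
      2 * m := by
    rw [wordSum, List.length_ofFn]
    refine hg.abs_birkhoff_sub_le hg1 fun j hj => ?_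
    rw [List.getD_eq_getElem _ _ (by simpa using hj)]
    simp
  have h4 : (M : ℝ) ≤ n := by exact_mod_cast (by omega : M ≤ n)
  rw [div_lt_iff₀ (by positivity)] at hM
  have h5 := mul_le_mul_of_nonneg_left h4 (by positivity : 0 ≤ ε / 2)
  have h2 := abs_le.1 h2
  have h3 := abs_le.1 h3
  rw [h1, abs_le]
  constructor <;> linarith [h2.1, h2.2, h3.1, h3.2]

theorem shift_iterate (j : ℕ) (x : ℕ → Fin 3) : shift^[j] x = fun i => x (i + j) := by
  induction j generalizing x with
  | zero => rfl
  | succ j ih =>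
    rw [Function.iterate_succ_apply, ih]
    funext i
    simp only [shift]
    congr 1

theorem measurable_shift : Measurable shift :=
  measurable_pi_lambda _ fun i => measurable_pi_apply (i + 1)

theorem continuous_shift : Continuous shift :=
  continuous_pi fun i => continuous_apply (i + 1)

theorem IsInvProb.integral_birkhoff {X : Set (ℕ → Fin 3)} {μ : Measure (ℕ → Fin 3)}
    (hμ : IsInvProb X μ) (hgm : Measurable g) (hg1 : ∀ x, |g x| ≤ 1) (n : ℕ) :
    Integrable (birkhoff g n) μ ∧ ∫ x, birkhoff g n x ∂μ = n * ∫ x, g x ∂μ := by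
  obtain ⟨hp, -, hinv⟩ := hμ
  have hmp : MeasurePreserving shift μ μ := ⟨measurable_shift, hinv⟩
  have hint : Integrable g μ := Integrable.of_bound hgm.aestronglyMeasurable 1 (ae_of_all _ hg1)
  have hj : ∀ j, Integrable (fun x : ℕ → Fin 3 => g fun i => x (i + j)) μ ∧
      ∫ x : ℕ → Fin 3, (g fun i => x (i + j)) ∂μ = ∫ x, g x ∂μ := by
    intro j
    have h1 := hmp.iterate j
    simp only [← shift_iterate]
    refine ⟨h1.integrable_comp_of_integrable hint, ?_⟩
    conv_rhs => rw [← h1.map_eq]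
    rw [integral_map h1.aemeasurable hgm.aestronglyMeasurable]
  refine ⟨integrable_finsetSum _ fun j _ => (hj j).1, ?_⟩
  simp only [birkhoff]
  rw [integral_finsetSum _ fun j _ => (hj j).1]
  simp [hj]

theorem IsInvProb.abs_integral_sub_le {X : Set (ℕ → Fin 3)} {μ : Measure (ℕ → Fin 3)}
    (hμ : IsInvProb X μ) (hgm : Measurable g) (hg1 : ∀ x, |g x| ≤ 1) {n : ℕ} (hn : 0 < n)
    {L ε : ℝ} (h : ∀ x ∈ X, |birkhoff g n x - L * n| ≤ ε * n) : |∫ x, g x ∂μ - L| ≤ ε := by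
  obtain ⟨hi, he⟩ := hμ.integral_birkhoff hgm hg1 n
  have hp := hμ.1
  have hX : ∀ᵐ x ∂μ, x ∈ X := hμ.2.1
  have h1 : ‖∫ x, (birkhoff g n x - L * n) ∂μ‖ ≤ ε * n * μ.real Set.univ :=
    norm_integral_le_of_norm_le_const (hX.mono fun x hx => h x hx)
  rw [integral_sub hi (integrable_const _), he, Real.norm_eq_abs] at h1
  simp only [integral_const, probReal_univ, smul_eq_mul, one_mul, mul_one] at h1
  have hn' : (0 : ℝ) < n := by exact_mod_cast hn
  rw [mul_comm L, ← mul_sub, abs_mul, abs_of_pos hn', mul_comm] at h1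
  exact le_of_mul_le_mul_right h1 hn'

end Birkhoff

/-! ### Existence and uniqueness of invariant measures -/

/-- **Krylov–Bogoliubov** for one-sided subshifts. -/
theorem exists_isInvProb_orbitClosure (ρ : ℕ → Fin 3) : ∃ μ, IsInvProb (orbitClosure ρ) μ := by
  set o : ℕ → ℕ → Fin 3 := fun n i => ρ (i + n) with ho
  have hsh : ∀ n, shift (o n) = o (n + 1) := fun n => by
    funext i
    simp only [ho, shift]
    congr 1
    omega
  set ν : ℕ → Measure (ℕ → Fin 3) := fun n =>
    ((n + 1 : ℕ) : ENNReal)⁻¹ • ∑ i ∈ Finset.range (n + 1), Measure.dirac (o i) with hν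
  have hprob : ∀ n, IsProbabilityMeasure (ν n) := fun n => ⟨by
    simp only [hν, Measure.smul_apply, Measure.finsetSum_apply, measure_univ, Finset.sum_const,
      Finset.card_range, smul_eq_mul, nsmul_eq_mul, mul_one]
    exact ENNReal.inv_mul_cancel (by simp) (by simp)⟩
  have hint : ∀ n (f : BoundedContinuousFunction (ℕ → Fin 3) ℝ),
      ∫ x, f x ∂(ν n) = ((n + 1 : ℕ) : ℝ)⁻¹ * ∑ i ∈ Finset.range (n + 1), f (o i) := by
    intro n f
    simp only [hν]
    rw [integral_smul_measure, integral_finsetSum_measure fun i _ => f.integrable _]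
    simp only [integral_dirac, ENNReal.toReal_inv, ENNReal.toReal_natCast, smul_eq_mul]
  set P : ℕ → ProbabilityMeasure (ℕ → Fin 3) := fun n => ⟨ν n, hprob n⟩ with hP
  set U : Ultrafilter ℕ := Ultrafilter.of atTop with hU
  obtain ⟨μ, -, hμ⟩ := (isCompact_univ (X := ProbabilityMeasure (ℕ → Fin 3))).ultrafilter_le_nhds
    (U.map P) (by simp)
  have hlim : Tendsto P U (𝓝 μ) := hμ
  refine ⟨μ, inferInstance, ?_, ?_⟩
  · have hopen : IsOpen (orbitClosure ρ)ᶜ := isClosed_closure.isOpen_compl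
    have h1 := ProbabilityMeasure.le_liminf_measure_open_of_tendsto hlim hopen
    have h2 : ∀ n, (P n : Measure (ℕ → Fin 3)) (orbitClosure ρ)ᶜ = 0 := by
      intro n
      simp only [hP, ProbabilityMeasure.coe_mk, hν, Measure.smul_apply, Measure.finsetSum_apply]
      rw [Finset.sum_eq_zero, smul_zero]
      intro i _
      rw [Measure.dirac_apply' _ hopen.measurableSet, Set.indicator_of_notMem]
      exact Set.notMem_compl_iff.2 (subset_closure ⟨i, rfl⟩)
    simp only [h2] at h1
    simpa using h1
  · have hmapc := ProbabilityMeasure.tendsto_map_of_tendsto_of_continuous P μ hlim continuous_shift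
    have hsame : Tendsto (fun n => (P n).map continuous_shift.measurable.aemeasurable) U (𝓝 μ) := by
      rw [ProbabilityMeasure.tendsto_iff_forall_integral_tendsto] at hlim ⊢
      intro f
      have h0 : Tendsto (fun n : ℕ => ((n + 1 : ℕ) : ℝ)⁻¹ * (2 * ‖f‖)) U (𝓝 0) := by
        have : Tendsto (fun n : ℕ => ((n + 1 : ℕ) : ℝ)⁻¹ * (2 * ‖f‖)) atTop (𝓝 (0 * (2 * ‖f‖))) :=
          ((tendsto_inv_atTop_nhds_zero_nat (𝕜 := ℝ)).comp (tendsto_add_atTop_nat 1)).mul_const _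
        rw [zero_mul] at this
        exact this.mono_left (Ultrafilter.of_le _)
      refine tendsto_of_tendsto_of_dist (hlim f) (squeeze_zero (fun _ => dist_nonneg) ?_ h0)
      intro n
      rw [ProbabilityMeasure.toMeasure_map, integral_map measurable_shift.aemeasurable
        f.continuous.aestronglyMeasurable]
      have h1 := hint n f
      have h2 := hint n (f.compContinuous ⟨shift, continuous_shift⟩)
      simp only [BoundedContinuousFunction.compContinuous_apply, ContinuousMap.coe_mk, hsh] at h2
      simp only [hP, ProbabilityMeasure.coe_mk]
      rw [h1, h2, Real.dist_eq, ← mul_sub, ← Finset.sum_sub_distrib, abs_mul, abs_inv,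
        Finset.sum_range_sub' fun i => f (o i), Nat.abs_cast]
      gcongr
      have a1 := abs_le.1 (f.norm_coe_le_norm (o 0))
      have a2 := abs_le.1 (f.norm_coe_le_norm (o (n + 1)))
      rw [abs_le]
      constructor <;> linarith [a1.1, a1.2, a2.1, a2.2]
    have := congrArg ProbabilityMeasure.toMeasure (tendsto_nhds_unique hmapc hsame)
    rwa [ProbabilityMeasure.toMeasure_map] at this

theorem measure_eq_of_integral_eq {μ ν : Measure (ℕ → Fin 3)} [IsProbabilityMeasure μ]
    [IsProbabilityMeasure ν]
    (h : ∀ m g, DependsOnFirst m g → Measurable g → (∀ x, |g x| ≤ 1) →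
      ∫ x, g x ∂μ = ∫ x, g x ∂ν) : μ = ν := by
  refine IsProjectiveLimit.unique (P := fun I : Finset ℕ => ν.map I.restrict) (fun I => ?_)
    (fun I => rfl)
  have hr : Measurable (I.restrict (π := fun _ : ℕ => Fin 3)) := Finset.measurable_restrict I
  refine Measure.ext_of_singleton fun u => ?_
  have hms := hr (measurableSet_singleton u)
  rw [Measure.map_apply hr (measurableSet_singleton u),
    Measure.map_apply hr (measurableSet_singleton u)]
  set S := I.restrict (π := fun _ : ℕ => Fin 3) ⁻¹' {u} with hS
  have := h (I.sup id + 1) (S.indicator 1) (fun x y hxy => by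
    have : x ∈ S ↔ y ∈ S := by
      have : I.restrict (π := fun _ : ℕ => Fin 3) x = I.restrict y := by
        funext i
        exact hxy i (Nat.lt_succ_of_le (Finset.le_sup (f := id) i.2))
      simp only [hS, Set.mem_preimage, this]
    by_cases hx : x ∈ S
    · rw [Set.indicator_of_mem hx, Set.indicator_of_mem (this.1 hx)]; rfl
    · rw [Set.indicator_of_notMem hx, Set.indicator_of_notMem (mt this.2 hx)])
    (measurable_one.indicator hms)
    (fun x => by by_cases hx : x ∈ S <;> simp [hx])
  rw [integral_indicator_one hms, integral_indicator_one hms] at this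
  exact (measureReal_eq_measureReal_iff).1 this

/-! ### Factors of the limit word -/

theorem exists_compApply_eq (k : ℕ → ℕ) (n d : ℕ) (w : List (Fin 3)) :
    ∃ y, compApply k (n + d) w = compApply k n y := by
  induction d generalizing w with
  | zero => exact ⟨w, rfl⟩
  | succ d ih => exact ih (applyChi (k (n + d + 1)) w)

theorem factor_infix {ρ : ℕ → Fin 3} {W : List (Fin 3)} (hW : IsPrefixSeq W ρ) {i n : ℕ}
    (h : i + n ≤ W.length) : (List.ofFn fun j : Fin n => ρ (j + i)) <:+: W := by
  have : (List.ofFn fun j : Fin n => ρ (j + i)) = (W.drop i).take n := by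
    refine List.ext_getElem (by simp; omega) fun j h1 h2 => ?_
    have hWj : ∀ (l : ℕ) (hl : l < W.length), W[l] = ρ l := fun l hl => by
      have := List.getElem_of_eq hW hl
      simpa using this
    simp only [List.getElem_ofFn, List.getElem_take, List.getElem_drop, hWj]
    rw [add_comm]
  rw [this]
  exact (List.take_prefix _ _).isInfix.trans (List.drop_suffix _ _).isInfix

/-- if `(k_i)` is a sequence of positive integers satisfying (★) with
`liminf k_i < ∞` (some value `≤ C` occurs infinitely often), then the subshift `(X,σ)`
is uniquely ergodic. -/
theorem statement16 (k : ℕ → ℕ) (hpos : ∀ i, 1 ≤ i → 1 ≤ k i) (hstar : StarCond k)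
    (hliminf : ∃ C : ℕ, ∀ N : ℕ, ∃ i ≥ N, k i ≤ C)
    (ρ : ℕ → Fin 3) (hρ : ∀ n : ℕ, IsPrefixSeq (compApply k n [2]) ρ) :
    ∃! μ : Measure (ℕ → Fin 3), IsInvProb (orbitClosure ρ) μ := by
  obtain ⟨C, hC⟩ := hliminf
  have hstar' : ∀ N, ∃ s ≥ N, ∃ j, 1 < k (s + 1) ∧ 1 < k (s + 2 * j + 2) := by
    intro N
    obtain ⟨i, hi, h1⟩ := hstar.1 (N + 1)
    obtain ⟨i', hi', h2⟩ := hstar.2 (i + 1)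
    refine ⟨2 * i - 1, by omega, i' - i - 1, ?_, ?_⟩
    · rwa [show 2 * i - 1 + 1 = 2 * i by omega]
    · rwa [show 2 * i - 1 + 2 * (i' - i - 1) + 2 = 2 * i' - 1 by omega]
  have hfac : ∀ p i n, ∃ y, (List.ofFn fun j : Fin n => ρ (j + i)) <:+: compApply k p y := by
    intro p i n
    obtain ⟨q, hq⟩ := (isChiCocycle_length hpos).exists_forall_ge_le hpos (fun a => by simp [compApply])
      (fun N => by obtain ⟨s, hs, j, h, -⟩ := hstar' N; exact ⟨s, hs, h⟩) (i + n)
    have hlen : i + n ≤ (compApply k (p + q) [2]).length := by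
      exact_mod_cast hq (p + q) (by omega) 2
    obtain ⟨y, hy⟩ := exists_compApply_eq k p q [2]
    exact ⟨y, hy ▸ factor_infix (hρ (p + q)) hlen⟩
  obtain ⟨μ, hμ⟩ := exists_isInvProb_orbitClosure ρ
  refine ⟨μ, hμ, fun ν hν => ?_⟩
  have := hμ.1
  have := hν.1
  refine measure_eq_of_integral_eq fun m g hg hgm hg1 => ?_
  refine eq_of_forall_dist_le fun ε hε => ?_
  obtain ⟨p, L, N, h⟩ := exists_uniform_average hpos hstar' hC (hg.abs_wordSum_append_le hg1)
    (fun w => abs_birkhoff_le hg1 _ _) (ε := ε / 2 / 2) (by positivity)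
  obtain ⟨n, hn, hX⟩ := hg.exists_birkhoff_close hg1 (ρ := ρ) (half_pos hε) (L := L) (N := N)
    fun i n hn => by
      obtain ⟨y, hy⟩ := hfac p i n
      simpa using h y _ hy (by simpa using hn)
  have h1 := abs_le.1 (hμ.abs_integral_sub_le hgm hg1 hn hX)
  have h2 := abs_le.1 (hν.abs_integral_sub_le hgm hg1 hn hX)
  rw [Real.dist_eq, abs_le]
  constructor <;> linarith [h1.1, h1.2, h2.1, h2.2]
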